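/- Let m ≥ 2, let θ = (θ_1,…,θ_m) ∈ T_m, and let t_0, t_1,…,t_{m−1} be real numbers with t_0 ∈ [−1, θ_1] and t_j ∈ [θ_j, θ_{j+1}] for 1 ≤ j ≤ m−1. Then for every integer q with 0 ≤ q ≤ m−1, setting q' = min(q+1, m−1), one has 0 ≤ w_m(θ)·u_m^q(t_1,…,t_{m−1}, 0) ≤ u_m^{q'}(θ) and 0 ≤ w̃_m(θ)·u_m^q(t_0, t_1,…,t_{m−1}) ≤ u_m^{q'}(θ). -/

import Mathlib

noncomputable section

/-- The fundamental simplex `T_m` of ordered tuples in `[-1,0]^m`. -/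
def TsetR (m : ℕ) : Set (Fin m → ℝ) :=
  {θ | (∀ i, θ i ∈ Set.Icc (-1 : ℝ) 0) ∧ Monotone θ}

/-- The polynomial `u_m^q` (with `0`-indexed coordinates):
`u_m^q(θ) = (∏_{i<j, j-i ≤ q} (θ_j - θ_i)) (∏_{i<j ≤ m-1, j-i ≥ m-q} (1 + θ_i - θ_j))`. -/
def umq (m q : ℕ) (θ : Fin m → ℝ) : ℝ :=
  (∏ p ∈ Finset.univ.filter
      (fun p : Fin m × Fin m => p.1 < p.2 ∧ (p.2 : ℕ) - (p.1 : ℕ) ≤ q),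
    (θ p.2 - θ p.1)) *
  (∏ p ∈ Finset.univ.filter
      (fun p : Fin m × Fin m => p.1 < p.2 ∧ (p.2 : ℕ) + 2 ≤ m ∧ m - q ≤ (p.2 : ℕ) - (p.1 : ℕ)),
    (1 + θ p.1 - θ p.2))

/-- `w_m(θ) = ∏_{j=1}^{m-1} (θ_{j+1} - θ_j)`. -/
def wm (m : ℕ) (θ : Fin m → ℝ) : ℝ :=
  ∏ j : Fin (m - 1),
    (θ ⟨(j : ℕ) + 1, by have := j.isLt; omega⟩ - θ ⟨(j : ℕ), by have := j.isLt; omega⟩)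

/-- `w̃_m(θ) = (1 + θ₁ - θ_{m-1}) w_m(θ)`. -/
def wtm (m : ℕ) (θ : Fin m → ℝ) : ℝ :=
  if h : 2 ≤ m then
    (1 + θ ⟨0, by omega⟩ - θ ⟨m - 2, by omega⟩) * wm m θ
  else wm m θ

/-- Extension of a finite tuple by zero to a sequence. -/
def extendZero (m : ℕ) (θ : Fin m → ℝ) (i : ℕ) : ℝ :=
  if h : i < m then θ ⟨i, h⟩ else 0

lemma extendZero_fin (m : ℕ) (θ : Fin m → ℝ) (i : Fin m) : extendZero m θ i = θ i := by
  simp [extendZero]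

/-- The factor of the first product of `u_{n+2}^q` collecting the pairs at distance `d + 1`. -/
def gapProd (n d : ℕ) (x : ℕ → ℝ) : ℝ :=
  ∏ i ∈ Finset.range (n + 1 - d), (x (i + d + 1) - x i)

/-- The factor of the second product of `u_{n+2}^q` collecting the pairs at distance
`n + 1 - k`. -/
def wrapProd (n k : ℕ) (x : ℕ → ℝ) : ℝ :=
  ∏ i ∈ Finset.range k, (1 + x i - x (i + (n + 1 - k)))

lemma prod_pairs_eq_prod_gaps (n q : ℕ) (F : ℕ → ℕ → ℝ) :
    ∏ p ∈ Finset.univ.filter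
      (fun p : Fin (n + 2) × Fin (n + 2) => p.1 < p.2 ∧ (p.2 : ℕ) - (p.1 : ℕ) ≤ q), F p.1 p.2 =
    ∏ d ∈ Finset.range q, ∏ i ∈ Finset.range (n + 1 - d), F i (i + d + 1) := by
  rw [Finset.prod_sigma']
  refine Finset.prod_bij (fun p _ => ⟨p.2 - p.1 - 1, p.1⟩) ?_ ?_ ?_ ?_
  · rintro ⟨i, j⟩ h
    simp only [Finset.mem_filter, Finset.mem_univ, true_and, Fin.lt_def] at h
    simp only [Finset.mem_sigma, Finset.mem_range]
    omega
  · rintro ⟨i, j⟩ h ⟨i', j'⟩ h' e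
    simp only [Finset.mem_filter, Finset.mem_univ, true_and, Fin.lt_def] at h h'
    simp only [Sigma.mk.injEq, heq_eq_eq] at e
    simp only [Prod.mk.injEq, Fin.ext_iff]
    omega
  · rintro ⟨d, i⟩ h
    simp only [Finset.mem_sigma, Finset.mem_range] at h
    refine ⟨(⟨i, by omega⟩, ⟨i + d + 1, by omega⟩), ?_, ?_⟩
    · simp only [Finset.mem_filter, Finset.mem_univ, true_and, Fin.lt_def]
      omega
    · simp only [Sigma.mk.injEq, heq_eq_eq, and_true]
      omega
  · rintro ⟨i, j⟩ h
    simp only [Finset.mem_filter, Finset.mem_univ, true_and, Fin.lt_def] at h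
    congr 1
    dsimp only
    omega

lemma prod_pairs_eq_prod_wraps (n q : ℕ) (hq : q ≤ n + 1) (F : ℕ → ℕ → ℝ) :
    ∏ p ∈ Finset.univ.filter
      (fun p : Fin (n + 2) × Fin (n + 2) =>
        p.1 < p.2 ∧ (p.2 : ℕ) + 2 ≤ n + 2 ∧ n + 2 - q ≤ (p.2 : ℕ) - (p.1 : ℕ)), F p.1 p.2 =
    ∏ k ∈ Finset.range q, ∏ i ∈ Finset.range k, F i (i + (n + 1 - k)) := by
  rw [Finset.prod_sigma']
  refine Finset.prod_bij (fun p _ => ⟨n + 1 - (p.2 - p.1), p.1⟩) ?_ ?_ ?_ ?_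
  · rintro ⟨i, j⟩ h
    simp only [Finset.mem_filter, Finset.mem_univ, true_and, Fin.lt_def] at h
    simp only [Finset.mem_sigma, Finset.mem_range]
    omega
  · rintro ⟨i, j⟩ h ⟨i', j'⟩ h' e
    simp only [Finset.mem_filter, Finset.mem_univ, true_and, Fin.lt_def] at h h'
    simp only [Sigma.mk.injEq, heq_eq_eq] at e
    simp only [Prod.mk.injEq, Fin.ext_iff]
    omega
  · rintro ⟨k, i⟩ h
    simp only [Finset.mem_sigma, Finset.mem_range] at h
    refine ⟨(⟨i, by omega⟩, ⟨i + (n + 1 - k), by omega⟩), ?_, ?_⟩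
    · simp only [Finset.mem_filter, Finset.mem_univ, true_and, Fin.lt_def]
      omega
    · simp only [Sigma.mk.injEq, heq_eq_eq, and_true]
      omega
  · rintro ⟨i, j⟩ h
    simp only [Finset.mem_filter, Finset.mem_univ, true_and, Fin.lt_def] at h
    congr 1
    dsimp only
    omega

lemma umq_eq_prod (n q : ℕ) (hq : q ≤ n + 1) (θ : Fin (n + 2) → ℝ) :
    umq (n + 2) q θ = ∏ d ∈ Finset.range q,
      (gapProd n d (extendZero (n + 2) θ) * wrapProd n d (extendZero (n + 2) θ)) := by
  rw [Finset.prod_mul_distrib]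
  unfold umq gapProd wrapProd
  rw [← prod_pairs_eq_prod_gaps n q
      (fun i j => extendZero (n + 2) θ j - extendZero (n + 2) θ i),
    ← prod_pairs_eq_prod_wraps n q hq
      (fun i j => 1 + extendZero (n + 2) θ i - extendZero (n + 2) θ j)]
  simp only [extendZero_fin]

lemma wm_eq_gapProd (n : ℕ) (θ : Fin (n + 2) → ℝ) :
    wm (n + 2) θ = gapProd n 0 (extendZero (n + 2) θ) := by
  unfold wm gapProd
  rw [Nat.sub_zero, Finset.prod_range]
  refine Finset.prod_congr rfl fun j _ => ?_
  have := j.isLt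
  simp only [extendZero]
  rw [dif_pos (by omega), dif_pos (by omega)]

section Bounds

variable {x y : ℕ → ℝ}

lemma gapProd_nonneg (hx : Monotone x) (n d : ℕ) : 0 ≤ gapProd n d x :=
  Finset.prod_nonneg fun i _ => sub_nonneg.2 (hx (by omega))

lemma wrapProd_nonneg (h1 : ∀ i, -1 ≤ x i) (h0 : ∀ i, x i ≤ 0) (n k : ℕ) :
    0 ≤ wrapProd n k x :=
  Finset.prod_nonneg fun i _ => by linarith [h1 i, h0 (i + (n + 1 - k))]

lemma prod_gap_wrap_nonneg (hx : Monotone x) (h1 : ∀ i, -1 ≤ x i) (h0 : ∀ i, x i ≤ 0)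
    (n q : ℕ) : 0 ≤ ∏ d ∈ Finset.range q, (gapProd n d x * wrapProd n d x) :=
  Finset.prod_nonneg fun d _ => mul_nonneg (gapProd_nonneg hx n d) (wrapProd_nonneg h1 h0 n d)

lemma gapProd_le_one (hx : Monotone x) (h1 : ∀ i, -1 ≤ x i) (h0 : ∀ i, x i ≤ 0) (n d : ℕ) :
    gapProd n d x ≤ 1 :=
  Finset.prod_le_one (fun i _ => sub_nonneg.2 (hx (by omega)))
    fun i _ => by linarith [h1 i, h0 (i + d + 1)]

lemma wrapProd_le_one (hx : Monotone x) (h1 : ∀ i, -1 ≤ x i) (h0 : ∀ i, x i ≤ 0) (n k : ℕ) :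
    wrapProd n k x ≤ 1 :=
  Finset.prod_le_one (fun i _ => by linarith [h1 i, h0 (i + (n + 1 - k))])
    fun i _ => by linarith [hx (show i ≤ i + (n + 1 - k) by omega)]

lemma prod_gap_wrap_le_of_le (hx : Monotone x) (h1 : ∀ i, -1 ≤ x i) (h0 : ∀ i, x i ≤ 0)
    (n : ℕ) {p q : ℕ} (hpq : p ≤ q) :
    ∏ d ∈ Finset.range q, (gapProd n d x * wrapProd n d x) ≤
      ∏ d ∈ Finset.range p, (gapProd n d x * wrapProd n d x) := by
  induction q, hpq using Nat.le_induction with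
  | base => exact le_rfl
  | succ q _ ih =>
    rw [Finset.prod_range_succ]
    exact (mul_le_of_le_one_right (prod_gap_wrap_nonneg hx h1 h0 n q)
      (mul_le_one₀ (gapProd_le_one hx h1 h0 n q) (wrapProd_nonneg h1 h0 n q)
        (wrapProd_le_one hx h1 h0 n q))).trans ih

lemma prod_gap_wrap_succ (n q : ℕ) :
    ∏ d ∈ Finset.range (q + 1), (gapProd n d x * wrapProd n d x) =
      gapProd n 0 x * ∏ d ∈ Finset.range q, (gapProd n (d + 1) x * wrapProd n (d + 1) x) := by
  rw [Finset.prod_range_succ', mul_comm]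
  simp [wrapProd]

lemma gap_wrap_shift_le (hx : Monotone x) (h1 : ∀ i, -1 ≤ x i) (h0 : ∀ i, x i ≤ 0)
    (hyx : ∀ i, y i ≤ x i) (hxy : ∀ i, x i ≤ y (i + 1)) (n d : ℕ) (hd : d < n + 1)
    (hn : y (n + 2) = 0) :
    gapProd n d (fun i => y (i + 1)) * wrapProd n d (fun i => y (i + 1)) ≤
      gapProd n (d + 1) x * wrapProd n (d + 1) x := by
  have hm : ∀ i j, i < j → y i ≤ y j := fun i j h =>
    (hyx i).trans ((hx (by omega : i ≤ j - 1)).trans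
      ((hxy (j - 1)).trans_eq (by rw [Nat.sub_add_cancel (by omega)])))
  have hy0 : ∀ i, y i ≤ 0 := fun i => (hyx i).trans (h0 i)
  have hy1 : ∀ i, -1 ≤ y (i + 1) := fun i => (h1 i).trans (hxy i)
  have hgap : gapProd n d (fun i => y (i + 1)) ≤ gapProd n (d + 1) x * (1 + x 0 - x (n - d)) := by
    unfold gapProd
    rw [show n + 1 - d = n - d + 1 by omega, Finset.prod_range_succ,
      show n + 1 - (d + 1) = n - d by omega]
    refine mul_le_mul (Finset.prod_le_prod (fun i _ => ?_) fun i _ => ?_) ?_ ?_ ?_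
    · exact sub_nonneg.2 (hm _ _ (by omega))
    · exact sub_le_sub (hyx _) (hxy _)
    · dsimp only
      rw [show n - d + d + 1 + 1 = n + 2 by omega, hn]
      linarith [hxy (n - d), h1 0]
    · exact sub_nonneg.2 (hm _ _ (by omega))
    · exact Finset.prod_nonneg fun i _ => sub_nonneg.2 (hx (by omega))
  have hwrap : wrapProd n d (fun i => y (i + 1)) * (1 + x 0 - x (n - d)) ≤
      wrapProd n (d + 1) x := by
    unfold wrapProd
    rw [Finset.prod_range_succ', zero_add, show n + 1 - (d + 1) = n - d by omega]
    refine mul_le_mul_of_nonneg_right (Finset.prod_le_prod (fun i _ => ?_) fun i _ => ?_) ?_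
    · linarith [hy1 i, hy0 (i + (n + 1 - d) + 1)]
    · rw [show i + (n + 1 - d) = i + 1 + (n - d) by omega]
      linarith [hyx (i + 1), hxy (i + 1 + (n - d))]
    · linarith [h1 0, h0 (n - d)]
  calc _ ≤ gapProd n (d + 1) x * (1 + x 0 - x (n - d)) * wrapProd n d (fun i => y (i + 1)) :=
        mul_le_mul_of_nonneg_right hgap (wrapProd_nonneg hy1 (fun i => hy0 _) n d)
    _ = gapProd n (d + 1) x * (wrapProd n d (fun i => y (i + 1)) * (1 + x 0 - x (n - d))) := by
        ring
    _ ≤ _ := mul_le_mul_of_nonneg_left hwrap (gapProd_nonneg hx n _)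

lemma prod_gap_wrap_shift_le (hx : Monotone x) (hy : Monotone y) (h1 : ∀ i, -1 ≤ x i)
    (h0 : ∀ i, x i ≤ 0) (hyx : ∀ i, y i ≤ x i) (hxy : ∀ i, x i ≤ y (i + 1)) (n q : ℕ)
    (hq : q ≤ n + 1) (hn : y (n + 2) = 0) :
    gapProd n 0 x * ∏ d ∈ Finset.range q,
      (gapProd n d (fun i => y (i + 1)) * wrapProd n d (fun i => y (i + 1))) ≤
    ∏ d ∈ Finset.range (q + 1), (gapProd n d x * wrapProd n d x) := by
  rw [prod_gap_wrap_succ]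
  refine mul_le_mul_of_nonneg_left (Finset.prod_le_prod (fun d _ => ?_) fun d hd => ?_)
    (gapProd_nonneg hx n 0)
  · exact mul_nonneg (gapProd_nonneg (fun i j h => hy (by omega)) n d)
      (wrapProd_nonneg (fun i => (h1 i).trans (hxy i)) (fun i => (hyx _).trans (h0 _)) n d)
  · exact gap_wrap_shift_le hx h1 h0 hyx hxy n d (by have := Finset.mem_range.1 hd; omega) hn

lemma prod_sub_zero_le (hx : Monotone x) (hy : Monotone y) (h1 : ∀ i, -1 ≤ y i)
    (h0 : ∀ i, x i ≤ 0) (hyx : ∀ i, y i ≤ x i) (n q : ℕ) :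
    (1 + x 0 - x n) * ∏ d ∈ Finset.range q, (y (d + 1) - y 0) ≤
      ∏ d ∈ Finset.range q, (1 + x d - x n) := by
  have hfac : ∀ d, 0 ≤ 1 + x d - x n := fun d => by linarith [h1 d, hyx d, h0 n]
  have hsub : ∀ d, 0 ≤ y (d + 1) - y 0 := fun d => sub_nonneg.2 (hy (by omega))
  cases q with
  | zero =>
    simp only [Finset.range_zero, Finset.prod_empty, mul_one]
    linarith [hx (Nat.zero_le n)]
  | succ p =>
    rw [Finset.prod_range_succ, Finset.prod_range_succ', mul_comm _ (1 + x 0 - x n)]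
    refine mul_le_mul_of_nonneg_left ?_ (hfac 0)
    refine (mul_le_of_le_one_right (Finset.prod_nonneg fun d _ => hsub d) ?_).trans
      (Finset.prod_le_prod (fun d _ => hsub d) fun d _ => ?_)
    · linarith [h1 0, hyx (p + 1), h0 (p + 1)]
    · linarith [h1 0, hyx (d + 1), h0 n]

lemma gap_le_mul_sub_zero (hy : Monotone y) (hyx : ∀ i, y i ≤ x i)
    (hxy : ∀ i, x i ≤ y (i + 1)) (n d : ℕ) (hd : d < n + 1) :
    gapProd n d y ≤ gapProd n (d + 1) x * (y (d + 1) - y 0) := by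
  unfold gapProd
  rw [show n + 1 - d = n - d + 1 by omega, Finset.prod_range_succ',
    show n + 1 - (d + 1) = n - d by omega, zero_add]
  refine mul_le_mul_of_nonneg_right (Finset.prod_le_prod (fun i _ => ?_) fun i _ => ?_)
    (sub_nonneg.2 (hy (by omega)))
  · exact sub_nonneg.2 (hy (by omega))
  · rw [show i + 1 + d + 1 = i + (d + 1) + 1 by omega]
    exact sub_le_sub (hyx _) (hxy _)

lemma wrap_mul_le (h1 : ∀ i, -1 ≤ y i) (h0 : ∀ i, x i ≤ 0)
    (hyx : ∀ i, y i ≤ x i) (hxy : ∀ i, x i ≤ y (i + 1)) (n d : ℕ) (hd : d < n + 1) :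
    wrapProd n d y * (1 + x d - x n) ≤ wrapProd n (d + 1) x := by
  unfold wrapProd
  rw [Finset.prod_range_succ, show d + (n + 1 - (d + 1)) = n by omega]
  refine mul_le_mul_of_nonneg_right (Finset.prod_le_prod (fun i _ => ?_) fun i _ => ?_) ?_
  · linarith [h1 i, hyx (i + (n + 1 - d)), h0 (i + (n + 1 - d))]
  · rw [show i + (n + 1 - d) = i + (n + 1 - (d + 1)) + 1 by omega]
    linarith [hyx i, hxy (i + (n + 1 - (d + 1)))]
  · linarith [h1 d, hyx d, h0 n]

lemma mul_prod_gap_wrap_le (hx : Monotone x) (hy : Monotone y) (h1 : ∀ i, -1 ≤ y i)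
    (h0 : ∀ i, x i ≤ 0) (hyx : ∀ i, y i ≤ x i) (hxy : ∀ i, x i ≤ y (i + 1)) (n q : ℕ)
    (hq : q ≤ n + 1) :
    (1 + x 0 - x n) * gapProd n 0 x * ∏ d ∈ Finset.range q, (gapProd n d y * wrapProd n d y) ≤
    ∏ d ∈ Finset.range (q + 1), (gapProd n d x * wrapProd n d x) := by
  have hy0 : ∀ i, y i ≤ 0 := fun i => (hyx i).trans (h0 i)
  have hfac : ∀ d, 0 ≤ 1 + x d - x n := fun d => by linarith [h1 d, hyx d, h0 n]
  have hlt : ∀ d ∈ Finset.range q, d < n + 1 := fun d hd =>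
    (Finset.mem_range.1 hd).trans_le hq
  have hG : ∏ d ∈ Finset.range q, gapProd n d y ≤ (∏ d ∈ Finset.range q, gapProd n (d + 1) x) *
      ∏ d ∈ Finset.range q, (y (d + 1) - y 0) := by
    rw [← Finset.prod_mul_distrib]
    exact Finset.prod_le_prod (fun d _ => gapProd_nonneg hy n d)
      fun d hd => gap_le_mul_sub_zero hy hyx hxy n d (hlt d hd)
  have hW : (∏ d ∈ Finset.range q, wrapProd n d y) * ∏ d ∈ Finset.range q, (1 + x d - x n) ≤
      ∏ d ∈ Finset.range q, wrapProd n (d + 1) x := by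
    rw [← Finset.prod_mul_distrib]
    exact Finset.prod_le_prod
      (fun d _ => mul_nonneg (wrapProd_nonneg h1 hy0 n d) (hfac d))
      fun d hd => wrap_mul_le h1 h0 hyx hxy n d (hlt d hd)
  have hGx : 0 ≤ ∏ d ∈ Finset.range q, gapProd n (d + 1) x :=
    Finset.prod_nonneg fun d _ => gapProd_nonneg hx n _
  have hWy : 0 ≤ ∏ d ∈ Finset.range q, wrapProd n d y :=
    Finset.prod_nonneg fun d _ => wrapProd_nonneg h1 hy0 n d
  rw [prod_gap_wrap_succ, mul_comm (1 + x 0 - x n), mul_assoc]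
  refine mul_le_mul_of_nonneg_left ?_ (gapProd_nonneg hx n 0)
  rw [Finset.prod_mul_distrib, Finset.prod_mul_distrib]
  calc _ ≤ (1 + x 0 - x n) * ((∏ d ∈ Finset.range q, gapProd n (d + 1) x) *
          (∏ d ∈ Finset.range q, (y (d + 1) - y 0)) * ∏ d ∈ Finset.range q, wrapProd n d y) :=
        mul_le_mul_of_nonneg_left (mul_le_mul_of_nonneg_right hG hWy) (hfac 0)
    _ = (∏ d ∈ Finset.range q, gapProd n (d + 1) x) * ((∏ d ∈ Finset.range q, wrapProd n d y) *
          ((1 + x 0 - x n) * ∏ d ∈ Finset.range q, (y (d + 1) - y 0))) := by ring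
    _ ≤ (∏ d ∈ Finset.range q, gapProd n (d + 1) x) * ((∏ d ∈ Finset.range q, wrapProd n d y) *
          ∏ d ∈ Finset.range q, (1 + x d - x n)) :=
        mul_le_mul_of_nonneg_left
          (mul_le_mul_of_nonneg_left (prod_sub_zero_le hx hy h1 h0 hyx n q) hWy) hGx
    _ ≤ _ := mul_le_mul_of_nonneg_left hW hGx

end Bounds

theorem statement14 (m : ℕ) (hm : 2 ≤ m)
    (θ : Fin m → ℝ) (hθ : θ ∈ TsetR m)
    (t : Fin m → ℝ)
    (ht0 : t ⟨0, by omega⟩ ∈ Set.Icc (-1 : ℝ) (θ ⟨0, by omega⟩))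
    (htj : ∀ j : Fin m, 0 < (j : ℕ) →
      t j ∈ Set.Icc (θ ⟨(j : ℕ) - 1, by have := j.isLt; omega⟩) (θ j))
    (q : ℕ) (hq : q ≤ m - 1) :
    (0 ≤ wm m θ * umq m q (fun i => if h : (i : ℕ) + 1 < m then t ⟨(i : ℕ) + 1, h⟩ else 0) ∧
      wm m θ * umq m q (fun i => if h : (i : ℕ) + 1 < m then t ⟨(i : ℕ) + 1, h⟩ else 0) ≤
        umq m (min (q + 1) (m - 1)) θ) ∧
    (0 ≤ wtm m θ * umq m q t ∧
      wtm m θ * umq m q t ≤ umq m (min (q + 1) (m - 1)) θ) := by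
  obtain ⟨n, rfl⟩ : ∃ n, m = n + 2 := ⟨m - 2, by omega⟩
  obtain ⟨hb, hmono⟩ := hθ
  set x := extendZero (n + 2) θ with hxdef
  set y := extendZero (n + 2) t with hydef
  have h0 : ∀ i, x i ≤ 0 := fun i => by
    simp only [hxdef, extendZero]
    split_ifs with h
    exacts [(hb _).2, le_rfl]
  have hx : Monotone x := fun i j hij => by
    by_cases h : j < n + 2
    · simp only [hxdef, extendZero, dif_pos h, dif_pos (hij.trans_lt h)]
      exact hmono hij
    · rw [show x j = 0 from dif_neg h]
      exact h0 i
  have hyx : ∀ i, y i ≤ x i := fun i => by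
    simp only [hxdef, hydef, extendZero]
    split_ifs with h
    · rcases Nat.eq_zero_or_pos i with rfl | hi
      exacts [ht0.2, (htj ⟨i, h⟩ hi).2]
    · exact le_rfl
  have hxy : ∀ i, x i ≤ y (i + 1) := fun i => by
    by_cases h : i + 1 < n + 2
    · simp only [hxdef, hydef, extendZero, dif_pos h, dif_pos (Nat.lt_of_succ_lt h)]
      exact (htj ⟨i + 1, h⟩ (Nat.succ_pos i)).1
    · rw [show y (i + 1) = 0 from dif_neg h]
      exact h0 i
  have hy : Monotone y := monotone_nat_of_le_succ fun i => (hyx i).trans (hxy i)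
  have hy0 : ∀ i, y i ≤ 0 := fun i => (hyx i).trans (h0 i)
  have hy1 : ∀ i, -1 ≤ y i := fun i =>
    (show -1 ≤ y 0 by simpa [hydef, extendZero] using ht0.1).trans (hy (Nat.zero_le i))
  have h1 : ∀ i, -1 ≤ x i := fun i => (hy1 i).trans (hyx i)
  have hfac : 0 ≤ 1 + x 0 - x n := by linarith [h1 0, h0 n]
  have hyn : y (n + 2) = 0 := dif_neg (lt_irrefl _)
  have hs : extendZero (n + 2)
      (fun i => if h : (i : ℕ) + 1 < n + 2 then t ⟨(i : ℕ) + 1, h⟩ else 0) =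
      fun i => y (i + 1) := by
    funext i
    simp only [hydef, extendZero]
    split_ifs <;> first | rfl | omega
  have hys : Monotone fun i => y (i + 1) := fun i j h => hy (Nat.succ_le_succ h)
  have hwt : wtm (n + 2) θ = (1 + x 0 - x n) * gapProd n 0 x := by
    rw [wtm, dif_pos hm, wm_eq_gapProd]
    simp [hxdef, extendZero]
  obtain ⟨p, hpq, hpn, hmin⟩ : ∃ p, p ≤ q ∧ p ≤ n + 1 ∧ min (q + 1) (n + 2 - 1) = p + 1 :=
    ⟨min q n, by omega, by omega, by omega⟩
  have hw0 : 0 ≤ gapProd n 0 x := gapProd_nonneg hx n 0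
  rw [hmin, umq_eq_prod n q hq, umq_eq_prod n q hq, umq_eq_prod n (p + 1) (by omega), hs,
    wm_eq_gapProd, hwt, ← hxdef, ← hydef]
  refine ⟨⟨mul_nonneg hw0 ?_, ?_⟩, mul_nonneg (mul_nonneg hfac hw0) ?_, ?_⟩
  · exact prod_gap_wrap_nonneg hys (fun i => hy1 _) (fun i => hy0 _) n q
  · exact (mul_le_mul_of_nonneg_left
      (prod_gap_wrap_le_of_le hys (fun i => hy1 _) (fun i => hy0 _) n hpq) hw0).trans
      (prod_gap_wrap_shift_le hx hy h1 h0 hyx hxy n p hpn hyn)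
  · exact prod_gap_wrap_nonneg hy hy1 hy0 n q
  · exact (mul_le_mul_of_nonneg_left (prod_gap_wrap_le_of_le hy hy1 hy0 n hpq)
      (mul_nonneg hfac hw0)).trans (mul_prod_gap_wrap_le hx hy hy1 h0 hyx hxy n p hpn)
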